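/- Let Ω ⊂ ℝ² be a connected open set with a smooth Riemannian metric g, and let a, b : Ω → ℝ be smooth with Δ_g a = Δ_g b = 0 (i.e. Σ_{j,k}∂_j(√(det g) gʲᵏ∂_k a) = 0 and likewise for b). Suppose db is nowhere vanishing on Ω and ⟨da, db⟩_g = Σ_{j,k} gʲᵏ ∂_j a ∂_k b = 0 on Ω. Then a and b are harmonic conjugates with respect to g up to a constant: there exists a constant λ ∈ ℝ such that da = λ ⋆db on Ω, where ⋆ is the Hodge star of g on 1-forms, given in coordinates by (⋆ω)_i = √(det g) · ε_{ij} gʲᵏ ω_k with ε the antisymmetric symbol ε₁₂ = 1 = −ε₂₁, ε₁₁ = ε₂₂ = 0. -/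

import Mathlib

/-- Partial derivative on `ℝ × ℝ` in the `i`-th coordinate direction. -/
noncomputable def pd (i : Fin 2) (f : ℝ × ℝ → ℝ) (p : ℝ × ℝ) : ℝ :=
  fderiv ℝ f p (if i = 0 then ((1:ℝ), (0:ℝ)) else (0, 1))

/-- The antisymmetric symbol on two indices: `ε₁₂ = 1 = −ε₂₁`, `ε₁₁ = ε₂₂ = 0`. -/
def eps (i j : Fin 2) : ℝ :=
  if i = 0 ∧ j = 1 then 1 else if i = 1 ∧ j = 0 then -1 else 0

theorem pd_add {i : Fin 2} {f h : ℝ × ℝ → ℝ} {p : ℝ × ℝ}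
    (hf : DifferentiableAt ℝ f p) (hh : DifferentiableAt ℝ h p) :
    pd i (fun q => f q + h q) p = pd i f p + pd i h p := by
  simp only [pd]
  rw [fderiv_fun_add hf hh]
  rfl

theorem pd_mul {i : Fin 2} {f h : ℝ × ℝ → ℝ} {p : ℝ × ℝ}
    (hf : DifferentiableAt ℝ f p) (hh : DifferentiableAt ℝ h p) :
    pd i (fun q => f q * h q) p = f p * pd i h p + h p * pd i f p := by
  simp only [pd]
  rw [fderiv_fun_mul hf hh]
  rfl

theorem pd_neg {i : Fin 2} {f : ℝ × ℝ → ℝ} {p : ℝ × ℝ} :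
    pd i (fun q => -f q) p = -pd i f p := by
  simp only [pd]
  rw [fderiv_fun_neg]
  rfl

theorem pd_congr {i : Fin 2} {f h : ℝ × ℝ → ℝ} {p : ℝ × ℝ} {Ω : Set (ℝ × ℝ)}
    (hΩ : IsOpen Ω) (hp : p ∈ Ω) (hfh : ∀ q ∈ Ω, f q = h q) : pd i f p = pd i h p := by
  have h' : f =ᶠ[nhds p] h := Filter.eventuallyEq_of_mem (hΩ.mem_nhds hp) hfh
  simp only [pd]
  rw [h'.fderiv_eq]

theorem fderiv_eq_zero_of_pd {f : ℝ × ℝ → ℝ} {p : ℝ × ℝ} (h0 : pd 0 f p = 0)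
    (h1 : pd 1 f p = 0) : fderiv ℝ f p = 0 := by
  simp only [pd, if_true, Fin.isValue, one_ne_zero, if_false] at h0 h1
  ext <;> simpa

theorem differentiableAt_pd {i : Fin 2} {f : ℝ × ℝ → ℝ} {p : ℝ × ℝ}
    (hf : ContDiffAt ℝ (⊤ : ℕ∞) f p) : DifferentiableAt ℝ (pd i f) p := by
  have h : DifferentiableAt ℝ (fderiv ℝ f) p :=
    (hf.fderiv_right (m := 1) (by norm_cast)).differentiableAt one_ne_zero
  unfold pd
  fun_prop

theorem pd_comm {f : ℝ × ℝ → ℝ} {p : ℝ × ℝ} (hf : ContDiffAt ℝ (⊤ : ℕ∞) f p) (i j : Fin 2) :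
    pd i (pd j f) p = pd j (pd i f) p := by
  have h : DifferentiableAt ℝ (fderiv ℝ f) p :=
    (hf.fderiv_right (m := 1) (by norm_cast)).differentiableAt one_ne_zero
  have hs : IsSymmSndFDerivAt ℝ f p := hf.isSymmSndFDerivAt (by
    rw [minSmoothness_of_isRCLikeNormedField]; norm_cast)
  have key : ∀ v w : ℝ × ℝ,
      fderiv ℝ (fun q => fderiv ℝ f q v) p w = fderiv ℝ (fderiv ℝ f) p w v := by
    intro v w
    rw [fderiv_clm_apply h (differentiableAt_const v)]
    simp
  unfold pd
  rw [key, key]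
  exact hs _ _

/-- If `λ ⋆W` is closed and `λ ⋆u` is coclosed, where `u` is closed, `W` is divergence free and
`u ⬝ W ≠ 0`, then `dλ = 0`. -/
theorem fderiv_eq_zero_of_closed_of_coclosed {l u₀ u₁ W₀ W₁ : ℝ × ℝ → ℝ} {p : ℝ × ℝ}
    (hl : DifferentiableAt ℝ l p)
    (hu₀ : DifferentiableAt ℝ u₀ p) (hu₁ : DifferentiableAt ℝ u₁ p)
    (hW₀ : DifferentiableAt ℝ W₀ p) (hW₁ : DifferentiableAt ℝ W₁ p)
    (hu : pd 0 u₁ p = pd 1 u₀ p) (hW : pd 0 W₀ p + pd 1 W₁ p = 0)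
    (hlW : pd 1 (fun q => l q * W₁ q) p = pd 0 (fun q => -(l q * W₀ q)) p)
    (hlu : pd 0 (fun q => l q * u₁ q) p + pd 1 (fun q => -(l q * u₀ q)) p = 0)
    (huW : u₀ p * W₀ p + u₁ p * W₁ p ≠ 0) : fderiv ℝ l p = 0 := by
  rw [pd_neg, pd_mul hl hW₁, pd_mul hl hW₀] at hlW
  rw [pd_neg, pd_mul hl hu₁, pd_mul hl hu₀] at hlu
  apply fderiv_eq_zero_of_pd
  · refine (mul_eq_zero.1 (?_ : (u₀ p * W₀ p + u₁ p * W₁ p) * pd 0 l p = 0)).resolve_left huW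
    linear_combination u₀ p * hlW + W₁ p * hlu - u₀ p * l p * hW - W₁ p * l p * hu
  · refine (mul_eq_zero.1 (?_ : (u₀ p * W₀ p + u₁ p * W₁ p) * pd 1 l p = 0)).resolve_left huW
    linear_combination u₁ p * hlW - W₀ p * hlu - u₁ p * l p * hW + W₀ p * l p * hu

theorem Matrix.inv_apply_fin_two (A : Matrix (Fin 2) (Fin 2) ℝ) :
    A⁻¹ 0 0 = A.det⁻¹ * A 1 1 ∧ A⁻¹ 0 1 = -(A.det⁻¹ * A 0 1) ∧
      A⁻¹ 1 0 = -(A.det⁻¹ * A 1 0) ∧ A⁻¹ 1 1 = A.det⁻¹ * A 0 0 := by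
  simp [Matrix.inv_def, Matrix.adjugate_fin_two]

/-- The symmetric unimodular coefficient matrix `√(det g) gʲᵏ` of a planar metric. -/
theorem Matrix.PosDef.sqrt_det_mul_inv_fin_two {A : Matrix (Fin 2) (Fin 2) ℝ} (hA : A.PosDef) :
    0 < √A.det * A⁻¹ 0 0 ∧ √A.det * A⁻¹ 1 0 = √A.det * A⁻¹ 0 1 ∧
      (√A.det * A⁻¹ 0 0) * (√A.det * A⁻¹ 1 1) - (√A.det * A⁻¹ 0 1) ^ 2 = 1 := by
  have hd : 0 < A.det := hA.det_pos
  have h00 : 0 < A⁻¹ 0 0 := hA.inv.diag_pos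
  have hsym : A 1 0 = A 0 1 := by simpa using hA.1.apply 0 1
  obtain ⟨e00, e01, e10, e11⟩ := A.inv_apply_fin_two
  refine ⟨mul_pos (Real.sqrt_pos.2 hd) h00, by rw [e01, e10, hsym], ?_⟩
  have hdet : A.det = A 0 0 * A 1 1 - A 0 1 ^ 2 := by rw [Matrix.det_fin_two, hsym]; ring
  have hs : √A.det ^ 2 = A.det := Real.sq_sqrt hd.le
  rw [e00, e01, e11]
  calc _ = √A.det ^ 2 * A.det⁻¹ ^ 2 * (A 0 0 * A 1 1 - A 0 1 ^ 2) := by ring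
    _ = 1 := by rw [hs, ← hdet]; field_simp

theorem differentiableAt_sqrt_det_mul_inv {G : ℝ × ℝ → Matrix (Fin 2) (Fin 2) ℝ} {p : ℝ × ℝ}
    (hG : ∀ i j, DifferentiableAt ℝ (fun q => G q i j) p) (hd : (G p).det ≠ 0) (i j : Fin 2) :
    DifferentiableAt ℝ (fun q => √(G q).det * (G q)⁻¹ i j) p := by
  have hdet : DifferentiableAt ℝ (fun q => (G q).det) p := by
    simp only [Matrix.det_fin_two]
    exact ((hG 0 0).mul (hG 1 1)).sub ((hG 0 1).mul (hG 1 0))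
  have hi : DifferentiableAt ℝ (fun q => (G q).det⁻¹) p := hdet.inv hd
  refine (hdet.sqrt hd).mul ?_
  fin_cases i <;> fin_cases j
  · simpa only [Fin.zero_eta, (G _).inv_apply_fin_two.1] using hi.fun_mul (hG 1 1)
  · simpa only [Fin.zero_eta, Fin.mk_one, (G _).inv_apply_fin_two.2.1] using (hi.fun_mul (hG 0 1)).fun_neg
  · simpa only [Fin.zero_eta, Fin.mk_one, (G _).inv_apply_fin_two.2.2.1] using
      (hi.fun_mul (hG 1 0)).fun_neg
  · simpa only [Fin.mk_one, (G _).inv_apply_fin_two.2.2.2] using hi.fun_mul (hG 0 0)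

/-- Conjugacy up to a constant for `div (N ∇a) = div (N ∇b) = 0`, with `N` symmetric and
unimodular, written in terms of `V = N ∇a` and `W = N ∇b`. -/
theorem exists_const_conjugate {Ω : Set (ℝ × ℝ)} (hΩ : IsOpen Ω) (hΩc : IsConnected Ω)
    {a b N₀₀ N₀₁ N₁₁ : ℝ × ℝ → ℝ}
    (h₀₀ : ∀ p ∈ Ω, DifferentiableAt ℝ N₀₀ p) (h₀₁ : ∀ p ∈ Ω, DifferentiableAt ℝ N₀₁ p)
    (h₁₁ : ∀ p ∈ Ω, DifferentiableAt ℝ N₁₁ p)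
    (hpos : ∀ p ∈ Ω, 0 < N₀₀ p) (hdet : ∀ p ∈ Ω, N₀₀ p * N₁₁ p - N₀₁ p ^ 2 = 1)
    (ha : ∀ p ∈ Ω, ContDiffAt ℝ (⊤ : ℕ∞) a p) (hb : ∀ p ∈ Ω, ContDiffAt ℝ (⊤ : ℕ∞) b p)
    (hadiv : ∀ p ∈ Ω, pd 0 (fun q => N₀₀ q * pd 0 a q + N₀₁ q * pd 1 a q) p +
      pd 1 (fun q => N₀₁ q * pd 0 a q + N₁₁ q * pd 1 a q) p = 0)
    (hbdiv : ∀ p ∈ Ω, pd 0 (fun q => N₀₀ q * pd 0 b q + N₀₁ q * pd 1 b q) p +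
      pd 1 (fun q => N₀₁ q * pd 0 b q + N₁₁ q * pd 1 b q) p = 0)
    (hdb : ∀ p ∈ Ω, ¬(pd 0 b p = 0 ∧ pd 1 b p = 0))
    (horth : ∀ p ∈ Ω, pd 0 a p * (N₀₀ p * pd 0 b p + N₀₁ p * pd 1 b p) +
      pd 1 a p * (N₀₁ p * pd 0 b p + N₁₁ p * pd 1 b p) = 0) :
    ∃ c : ℝ, ∀ p ∈ Ω, pd 0 a p = c * (N₀₁ p * pd 0 b p + N₁₁ p * pd 1 b p) ∧
      pd 1 a p = -(c * (N₀₀ p * pd 0 b p + N₀₁ p * pd 1 b p)) := by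
  set W₀ : ℝ × ℝ → ℝ := fun q => N₀₀ q * pd 0 b q + N₀₁ q * pd 1 b q with hW₀
  set W₁ : ℝ × ℝ → ℝ := fun q => N₀₁ q * pd 0 b q + N₁₁ q * pd 1 b q with hW₁
  set l : ℝ × ℝ → ℝ := fun q => (pd 0 a q * W₁ q - pd 1 a q * W₀ q) / (W₀ q ^ 2 + W₁ q ^ 2)
    with hl
  have huW : ∀ p ∈ Ω, pd 0 b p * W₀ p + pd 1 b p * W₁ p ≠ 0 := by
    intro p hp h0
    have e : W₀ p ^ 2 + pd 1 b p ^ 2 = 0 := by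
      simp only [hW₀, hW₁] at h0 ⊢
      linear_combination N₀₀ p * h0 - pd 1 b p ^ 2 * hdet p hp
    have e1 : pd 1 b p = 0 := by nlinarith [sq_nonneg (W₀ p), sq_nonneg (pd 1 b p)]
    have e0 : W₀ p = 0 := by nlinarith [sq_nonneg (W₀ p), sq_nonneg (pd 1 b p)]
    refine hdb p hp ⟨?_, e1⟩
    simp only [hW₀, e1, mul_zero, add_zero] at e0
    exact (mul_eq_zero.1 e0).resolve_left (hpos p hp).ne'
  have hWne : ∀ p ∈ Ω, W₀ p ^ 2 + W₁ p ^ 2 ≠ 0 := by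
    intro p hp h0
    have e0 : W₀ p = 0 := by nlinarith [sq_nonneg (W₀ p), sq_nonneg (W₁ p)]
    have e1 : W₁ p = 0 := by nlinarith [sq_nonneg (W₀ p), sq_nonneg (W₁ p)]
    exact huW p hp (by rw [e0, e1]; ring)
  have hlmul : ∀ p ∈ Ω, l p * (W₀ p ^ 2 + W₁ p ^ 2) = pd 0 a p * W₁ p - pd 1 a p * W₀ p :=
    fun p hp => div_mul_cancel₀ _ (hWne p hp)
  have ha₀ : ∀ p ∈ Ω, pd 0 a p = l p * W₁ p := fun p hp => by
    apply mul_right_cancel₀ (hWne p hp)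
    linear_combination W₀ p * horth p hp - W₁ p * hlmul p hp
  have ha₁ : ∀ p ∈ Ω, pd 1 a p = -(l p * W₀ p) := fun p hp => by
    apply mul_right_cancel₀ (hWne p hp)
    linear_combination W₁ p * horth p hp + W₀ p * hlmul p hp
  have hV₀ : ∀ p ∈ Ω, N₀₀ p * pd 0 a p + N₀₁ p * pd 1 a p = l p * pd 1 b p := fun p hp => by
    rw [ha₀ p hp, ha₁ p hp]
    simp only [hW₀, hW₁]
    linear_combination l p * pd 1 b p * hdet p hp
  have hV₁ : ∀ p ∈ Ω, N₀₁ p * pd 0 a p + N₁₁ p * pd 1 a p = -(l p * pd 0 b p) := fun p hp => by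
    rw [ha₀ p hp, ha₁ p hp]
    simp only [hW₀, hW₁]
    linear_combination -l p * pd 0 b p * hdet p hp
  have hW₀d : ∀ p ∈ Ω, DifferentiableAt ℝ W₀ p := fun p hp =>
    ((h₀₀ p hp).mul (differentiableAt_pd (hb p hp))).add
      ((h₀₁ p hp).mul (differentiableAt_pd (hb p hp)))
  have hW₁d : ∀ p ∈ Ω, DifferentiableAt ℝ W₁ p := fun p hp =>
    ((h₀₁ p hp).mul (differentiableAt_pd (hb p hp))).add
      ((h₁₁ p hp).mul (differentiableAt_pd (hb p hp)))
  have hld : ∀ p ∈ Ω, DifferentiableAt ℝ l p := fun p hp => by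
    have hn : DifferentiableAt ℝ (fun q => pd 0 a q * W₁ q - pd 1 a q * W₀ q) p :=
      ((differentiableAt_pd (ha p hp)).fun_mul (hW₁d p hp)).fun_sub
        ((differentiableAt_pd (ha p hp)).fun_mul (hW₀d p hp))
    have hd : DifferentiableAt ℝ (fun q => W₀ q ^ 2 + W₁ q ^ 2) p :=
      ((hW₀d p hp).fun_pow 2).fun_add ((hW₁d p hp).fun_pow 2)
    simpa only [hl, div_eq_mul_inv] using hn.fun_mul (hd.fun_inv (hWne p hp))
  have hzero : ∀ p ∈ Ω, fderiv ℝ l p = 0 := fun p hp => by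
    refine fderiv_eq_zero_of_closed_of_coclosed (hld p hp) (differentiableAt_pd (hb p hp))
      (differentiableAt_pd (hb p hp)) (hW₀d p hp) (hW₁d p hp) (pd_comm (hb p hp) 0 1)
      (hbdiv p hp) ?_ ?_ (huW p hp)
    · rw [← pd_congr hΩ hp ha₀, ← pd_congr hΩ hp ha₁]
      exact pd_comm (ha p hp) 1 0
    · rw [← pd_congr hΩ hp hV₀, ← pd_congr hΩ hp hV₁]
      exact hadiv p hp
  obtain ⟨c, hc⟩ := hΩ.exists_is_const_of_fderiv_eq_zero hΩc.isPreconnected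
    (fun p hp => (hld p hp).differentiableWithinAt) hzero
  refine ⟨c, fun p hp => ⟨?_, ?_⟩⟩
  · rw [ha₀ p hp, hc p hp]
  · rw [ha₁ p hp, hc p hp]

/-- Two `g`-harmonic functions with `db` nowhere vanishing and
`⟨da, db⟩_g = 0` are harmonic conjugates up to a constant: `da = λ ⋆db`. -/
theorem stmt_19 (Ω : Set (ℝ × ℝ)) (hΩopen : IsOpen Ω) (hΩconn : IsConnected Ω)
    (G : ℝ × ℝ → Matrix (Fin 2) (Fin 2) ℝ)
    (hGsmooth : ∀ i j, ContDiffOn ℝ (⊤ : ℕ∞) (fun p => G p i j) Ω)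
    (hGpos : ∀ p ∈ Ω, (G p).PosDef)
    (a b : ℝ × ℝ → ℝ)
    (ha : ContDiffOn ℝ (⊤ : ℕ∞) a Ω) (hb : ContDiffOn ℝ (⊤ : ℕ∞) b Ω)
    (haharm : ∀ p ∈ Ω, ∑ j, ∑ k,
      pd j (fun q => Real.sqrt (G q).det * (G q)⁻¹ j k * pd k a q) p = 0)
    (hbharm : ∀ p ∈ Ω, ∑ j, ∑ k,
      pd j (fun q => Real.sqrt (G q).det * (G q)⁻¹ j k * pd k b q) p = 0)
    (hdb : ∀ p ∈ Ω, ¬(pd 0 b p = 0 ∧ pd 1 b p = 0))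
    (horth : ∀ p ∈ Ω, ∑ j, ∑ k, (G p)⁻¹ j k * pd j a p * pd k b p = 0) :
    ∃ lam : ℝ, ∀ p ∈ Ω, ∀ i : Fin 2,
      pd i a p = lam *
        (Real.sqrt (G p).det * ∑ j, ∑ k, eps i j * (G p)⁻¹ j k * pd k b p) := by
  have hGd : ∀ p ∈ Ω, ∀ i j, DifferentiableAt ℝ (fun q => √(G q).det * (G q)⁻¹ i j) p :=
    fun p hp => differentiableAt_sqrt_det_mul_inv
      (fun i j => ((hGsmooth i j).contDiffAt (hΩopen.mem_nhds hp)).differentiableAt (by simp))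
      (hGpos p hp).det_pos.ne'
  have hN := fun p hp => (hGpos p hp).sqrt_det_mul_inv_fin_two
  have ha' : ∀ p ∈ Ω, ContDiffAt ℝ (⊤ : ℕ∞) a p := fun p hp =>
    ha.contDiffAt (hΩopen.mem_nhds hp)
  have hb' : ∀ p ∈ Ω, ContDiffAt ℝ (⊤ : ℕ∞) b p := fun p hp =>
    hb.contDiffAt (hΩopen.mem_nhds hp)
  have hdiv : ∀ f : ℝ × ℝ → ℝ, (∀ p ∈ Ω, ContDiffAt ℝ (⊤ : ℕ∞) f p) →
      (∀ p ∈ Ω, ∑ j, ∑ k, pd j (fun q => √(G q).det * (G q)⁻¹ j k * pd k f q) p = 0) →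
      ∀ p ∈ Ω,
        pd 0 (fun q => √(G q).det * (G q)⁻¹ 0 0 * pd 0 f q +
          √(G q).det * (G q)⁻¹ 0 1 * pd 1 f q) p +
        pd 1 (fun q => √(G q).det * (G q)⁻¹ 0 1 * pd 0 f q +
          √(G q).det * (G q)⁻¹ 1 1 * pd 1 f q) p = 0 := by
    intro f hf h p hp
    have hd : ∀ i j k, DifferentiableAt ℝ (fun q => √(G q).det * (G q)⁻¹ i j * pd k f q) p :=
      fun i j k => (hGd p hp i j).mul (differentiableAt_pd (hf p hp))
    have hs : pd 1 (fun q => √(G q).det * (G q)⁻¹ 1 0 * pd 0 f q) p =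
        pd 1 (fun q => √(G q).det * (G q)⁻¹ 0 1 * pd 0 f q) p :=
      pd_congr hΩopen hp fun q hq => by rw [(hN q hq).2.1]
    rw [pd_add (hd 0 0 0) (hd 0 1 1), pd_add (hd 0 1 0) (hd 1 1 1), ← hs]
    simpa only [Fin.sum_univ_two] using h p hp
  obtain ⟨c, hc⟩ := exists_const_conjugate hΩopen hΩconn
    (fun p hp => hGd p hp 0 0) (fun p hp => hGd p hp 0 1) (fun p hp => hGd p hp 1 1)
    (fun p hp => (hN p hp).1) (fun p hp => (hN p hp).2.2) ha' hb'
    (hdiv a ha' haharm) (hdiv b hb' hbharm) hdb (fun p hp => by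
      have h := horth p hp
      simp only [Fin.sum_univ_two] at h
      linear_combination √(G p).det * h - pd 1 a p * pd 0 b p * (hN p hp).2.1)
  refine ⟨c, fun p hp i => ?_⟩
  obtain ⟨h0, h1⟩ := hc p hp
  have e00 : eps 0 0 = 0 := by simp [eps]
  have e01 : eps 0 1 = 1 := by simp [eps]
  have e10 : eps 1 0 = -1 := by simp [eps]
  have e11 : eps 1 1 = 0 := by simp [eps]
  fin_cases i
  · simp only [Fin.zero_eta, Fin.sum_univ_two, e00, e01, h0]
    linear_combination -c * pd 0 b p * (hN p hp).2.1
  · simp only [Fin.mk_one, Fin.sum_univ_two, e10, e11, h1]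
    ring
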